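/- Let Assumption (M') hold and suppose P(Y_0 ∉ 𝒴_n) → 0 as n → ∞. If (X_t) and (X'_t) are Markov chains in the same random environment (Y_t) with kernel Q, started from initial conditions X_0 and X'_0 whose joint laws with (Y_k)_{k∈ℤ} both lie in 𝔐_b, then ‖L(X_t, (Y_{t+k})_{k∈ℤ}) − L(X'_t, (Y_{t+k})_{k∈ℤ})‖_TV → 0 as t → ∞; in particular the total-variation limit μ♯ of L(X_t, (Y_{t+k})_{k∈ℤ}) does not depend on the choice of initial condition in 𝔐_b. -/

import Mathlib

open MeasureTheory ProbabilityTheory Filter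

/-- Total variation distance between two measures, defined as in the paper:
`‖μ − ν‖_TV = sup_{|φ|≤1} |∫ φ dμ − ∫ φ dν|`. -/
noncomputable def tvDist {X : Type*} [MeasurableSpace X] (μ ν : Measure X) : ℝ :=
  ⨆ φ : {φ : X → ℝ // Measurable φ ∧ ∀ x, |φ x| ≤ 1},
    |∫ x, φ.1 x ∂μ - ∫ x, φ.1 x ∂ν|

/-- `X` is a Markov chain in the random environment `Y` with kernel `Q`:
`P(X_{t+1} ∈ A | σ(Y_j, j ∈ ℤ; X_j, 0 ≤ j ≤ t)) = Q(X_t, Y_t, A)` a.s. -/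
def IsMCRE {𝒳 𝒴 Ω : Type*} [MeasurableSpace 𝒳] [MeasurableSpace 𝒴] [MeasurableSpace Ω]
    (P : Measure Ω) (Q : Kernel (𝒳 × 𝒴) 𝒳) (Y : ℤ → Ω → 𝒴) (X : ℕ → Ω → 𝒳) : Prop :=
  ∀ t : ℕ, ∀ A : Set 𝒳, MeasurableSet A →
    (P[fun ω => A.indicator (fun _ => (1:ℝ)) (X (t + 1) ω) |
        (⨆ j : ℤ, MeasurableSpace.comap (Y j) inferInstance) ⊔
          (⨆ j : Fin (t + 1), MeasurableSpace.comap (X j) inferInstance)])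
      =ᵐ[P] fun ω => ((Q (X t ω, Y t ω)) A).toReal

section TotalVariation

variable {E : Type*} [MeasurableSpace E]

lemma integrable_of_abs_le {μ : Measure E} [IsFiniteMeasure μ] {φ : E → ℝ} {c : ℝ}
    (hφ : Measurable φ) (hc : ∀ x, |φ x| ≤ c) : Integrable φ μ :=
  Integrable.of_bound hφ.aestronglyMeasurable c (ae_of_all _ hc)

lemma abs_integral_le_of_abs_le {μ : Measure E} [IsFiniteMeasure μ] {φ : E → ℝ} {c : ℝ}
    (hc : ∀ x, |φ x| ≤ c) : |∫ x, φ x ∂μ| ≤ c * μ.real Set.univ := by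
  simpa using norm_integral_le_of_norm_le_const (μ := μ) (f := φ) (ae_of_all _ hc)

lemma tvDist_le {μ ν : Measure E} {c : ℝ}
    (h : ∀ φ : E → ℝ, Measurable φ → (∀ x, |φ x| ≤ 1) → |∫ x, φ x ∂μ - ∫ x, φ x ∂ν| ≤ c) :
    tvDist μ ν ≤ c := by
  have : Nonempty {φ : E → ℝ // Measurable φ ∧ ∀ x, |φ x| ≤ 1} :=
    ⟨⟨fun _ => 0, measurable_const, by simp⟩⟩
  exact ciSup_le fun φ => h φ.1 φ.2.1 φ.2.2

lemma tvDist_nonneg (μ ν : Measure E) : 0 ≤ tvDist μ ν :=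
  Real.iSup_nonneg fun _ => abs_nonneg _

lemma abs_integral_sub_le_tvDist {μ ν : Measure E} [IsProbabilityMeasure μ]
    [IsProbabilityMeasure ν] {φ : E → ℝ} (hφ : Measurable φ) (h1 : ∀ x, |φ x| ≤ 1) :
    |∫ x, φ x ∂μ - ∫ x, φ x ∂ν| ≤ tvDist μ ν := by
  refine le_ciSup (f := fun φ : {φ : E → ℝ // Measurable φ ∧ ∀ x, |φ x| ≤ 1} =>
    |∫ x, φ.1 x ∂μ - ∫ x, φ.1 x ∂ν|) ⟨2, ?_⟩ ⟨φ, hφ, h1⟩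
  rintro _ ⟨ψ, rfl⟩
  have hμ := abs_integral_le_of_abs_le (μ := μ) ψ.2.2
  have hν := abs_integral_le_of_abs_le (μ := ν) ψ.2.2
  simp only [probReal_univ, mul_one] at hμ hν
  exact (abs_sub _ _).trans (by linarith)

lemma tvDist_le_add {μ ν ρ : Measure E} [IsProbabilityMeasure μ] [IsProbabilityMeasure ν]
    [IsProbabilityMeasure ρ] : tvDist ν ρ ≤ tvDist μ ν + tvDist μ ρ := by
  refine tvDist_le fun φ hφ h1 => ?_
  have hν := abs_integral_sub_le_tvDist (μ := μ) (ν := ν) hφ h1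
  have hρ := abs_integral_sub_le_tvDist (μ := μ) (ν := ρ) hφ h1
  rw [abs_sub_comm] at hν
  exact (abs_sub_le _ (∫ x, φ x ∂μ) _).trans (add_le_add hν hρ)

lemma abs_integral_sub_mul_integral_le {μ ν : Measure E} [IsProbabilityMeasure μ]
    [IsProbabilityMeasure ν] {a : ℝ} (ha : 0 ≤ a)
    (h : ∀ A, MeasurableSet A → ENNReal.ofReal a * ν A ≤ μ A)
    {φ : E → ℝ} (hφ : Measurable φ) (h1 : ∀ x, |φ x| ≤ 1) :
    |∫ x, φ x ∂μ - a * ∫ x, φ x ∂ν| ≤ 1 - a := by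
  set ρ : Measure E := ENNReal.ofReal a • ν with hρ
  have : IsFiniteMeasure ρ := Measure.smul_finite _ ENNReal.ofReal_ne_top
  have hle : ρ ≤ μ := Measure.le_iff.2 fun A hA => by simpa [hρ] using h A hA
  have hadd : μ - ρ + ρ = μ := Measure.sub_add_cancel_of_le hle
  have hint : ∫ x, φ x ∂μ = ∫ x, φ x ∂(μ - ρ) + a * ∫ x, φ x ∂ν := by
    conv_lhs => rw [← hadd]
    rw [integral_add_measure (integrable_of_abs_le hφ h1) (integrable_of_abs_le hφ h1), hρ,
      integral_smul_measure, ENNReal.toReal_ofReal ha, smul_eq_mul]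
  have hmass : (μ - ρ).real Set.univ = 1 - a := by
    have hreal : (μ - ρ + ρ).real Set.univ = 1 := by rw [hadd]; simp
    rw [measureReal_add_apply] at hreal
    have hρa : ρ.real Set.univ = a := by
      simp [hρ, Measure.real, ENNReal.toReal_ofReal ha]
    linarith
  rw [hint, add_sub_cancel_right, ← hmass]
  simpa using abs_integral_le_of_abs_le (μ := μ - ρ) h1

end TotalVariation

section RandomEnvironment

variable {𝒳 𝒴 Ω : Type*} [MeasurableSpace 𝒳] [MeasurableSpace 𝒴] [MeasurableSpace Ω]
  {P : Measure Ω} [IsProbabilityMeasure P] {Q : Kernel (𝒳 × 𝒴) 𝒳} [IsMarkovKernel Q]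
  {Y : ℤ → Ω → 𝒴} {X X' : ℕ → Ω → 𝒳}

lemma measurable_environment (hY : ∀ j, Measurable (Y j)) : Measurable fun ω j => Y j ω :=
  measurable_pi_lambda _ hY

/-- The σ-algebra generated by the whole environment and by the chain up to time `t`. -/
abbrev history (Y : ℤ → Ω → 𝒴) (X : ℕ → Ω → 𝒳) (t : ℕ) : MeasurableSpace Ω :=
  (⨆ j : ℤ, MeasurableSpace.comap (Y j) inferInstance) ⊔
    (⨆ j : Fin (t + 1), MeasurableSpace.comap (X j) inferInstance)

lemma history_le (hY : ∀ j, Measurable (Y j)) (hX : ∀ t, Measurable (X t)) (t : ℕ) :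
    history Y X t ≤ ‹MeasurableSpace Ω› :=
  sup_le (iSup_le fun j => (hY j).comap_le) (iSup_le fun j => (hX j).comap_le)

lemma IsMCRE.map_environment_prod (hY : ∀ j, Measurable (Y j)) (hX : ∀ t, Measurable (X t))
    (h : IsMCRE P Q Y X) (t : ℕ) :
    P.map (fun ω => ((fun j => Y j ω), X (t + 1) ω)) =
      (P ⊗ₘ Q.comap (fun ω => (X t ω, Y t ω)) ((hX t).prodMk (hY t))).map
        (fun p => ((fun j => Y j p.1), p.2)) := by
  have hYm := measurable_environment hY
  have hm1 : Measurable (fun ω => ((fun j => Y j ω), X (t + 1) ω)) := hYm.prodMk (hX _)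
  have hm2 : Measurable (fun p : Ω × 𝒳 => ((fun j => Y j p.1), p.2)) :=
    (hYm.comp measurable_fst).prodMk measurable_snd
  have := Measure.isProbabilityMeasure_map (μ := P) hm1.aemeasurable
  refine Measure.ext_prod fun {B A} hB hA => ?_
  rw [Measure.map_apply hm1 (hB.prod hA), Measure.map_apply hm2 (hB.prod hA)]
  have hYm' : Measurable[history Y X t] fun ω j => Y j ω := by
    refine @measurable_pi_lambda _ _ _ (history Y X t) _ _ fun j => ?_
    exact measurable_iff_comap_le.2 ((le_iSup (fun j : ℤ =>
      MeasurableSpace.comap (Y j) inferInstance) j).trans le_sup_left)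
  have hBm : MeasurableSet[history Y X t] ((fun ω j => Y j ω) ⁻¹' B) := hYm' hB
  have hBΩ : MeasurableSet ((fun ω j => Y j ω) ⁻¹' B) := hYm hB
  have hAX : MeasurableSet (X (t + 1) ⁻¹' A) := hX _ hA
  have hpre1 : (fun ω => ((fun j => Y j ω), X (t + 1) ω)) ⁻¹' (B ×ˢ A) =
      X (t + 1) ⁻¹' A ∩ (fun ω j => Y j ω) ⁻¹' B := by
    ext ω; simp [and_comm]
  have hpre2 : (fun p : Ω × 𝒳 => ((fun j => Y j p.1), p.2)) ⁻¹' (B ×ˢ A) =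
      ((fun ω j => Y j ω) ⁻¹' B) ×ˢ A := by
    ext ω; simp
  have hcond := setIntegral_condExp (μ := P) (history_le hY hX t)
    (f := fun ω => A.indicator (fun _ => (1 : ℝ)) (X (t + 1) ω))
    ((integrable_const (1 : ℝ)).indicator hAX) hBm
  rw [setIntegral_congr_ae hBΩ ((h t A hA).mono fun _ hω _ => hω)] at hcond
  rw [hpre1, hpre2, Measure.compProd_apply_prod hBΩ hA]
  have hlhs : ∫ ω in (fun ω j => Y j ω) ⁻¹' B, A.indicator (fun _ => (1 : ℝ)) (X (t + 1) ω) ∂P =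
      (P (X (t + 1) ⁻¹' A ∩ (fun ω j => Y j ω) ⁻¹' B)).toReal := by
    have := integral_indicator_one (μ := P.restrict ((fun ω j => Y j ω) ⁻¹' B)) hAX
    rw [Measure.real, Measure.restrict_apply hAX] at this
    exact this
  have hmeas : Measurable fun ω => Q (X t ω, Y t ω) A :=
    (Q.measurable_coe hA).comp ((hX t).prodMk (hY t))
  have hrhs : ∫ ω in (fun ω j => Y j ω) ⁻¹' B, (Q (X t ω, Y t ω) A).toReal ∂P =
      (∫⁻ ω in (fun ω j => Y j ω) ⁻¹' B, Q (X t ω, Y t ω) A ∂P).toReal :=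
    integral_toReal hmeas.aemeasurable (ae_of_all _ fun _ => measure_lt_top _ _)
  rw [hlhs, hrhs] at hcond
  have hfin : ∫⁻ ω in (fun ω j => Y j ω) ⁻¹' B, Q (X t ω, Y t ω) A ∂P ≠ ⊤ := by
    refine ((lintegral_mono fun ω => prob_le_one).trans_lt ?_).ne
    simp
  exact ((ENNReal.toReal_eq_toReal_iff' hfin (measure_ne_top _ _)).1 hcond).symm

lemma IsMCRE.integral_succ (hY : ∀ j, Measurable (Y j)) (hX : ∀ t, Measurable (X t))
    (h : IsMCRE P Q Y X) (t : ℕ) {φ : 𝒳 × (ℤ → 𝒴) → ℝ} (hφ : Measurable φ)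
    (h1 : ∀ p, |φ p| ≤ 1) :
    ∫ ω, φ (X (t + 1) ω, fun j => Y j ω) ∂P =
      ∫ ω, ∫ z, φ (z, fun j => Y j ω) ∂Q (X t ω, Y t ω) ∂P := by
  have hYm := measurable_environment hY
  have hm2 : Measurable (fun p : Ω × 𝒳 => ((fun j => Y j p.1), p.2)) :=
    (hYm.comp measurable_fst).prodMk measurable_snd
  have hφs : Measurable fun p : (ℤ → 𝒴) × 𝒳 => φ p.swap := hφ.comp measurable_swap
  have hl := integral_map (μ := P) (hYm.prodMk (hX (t + 1))).aemeasurable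
    hφs.aestronglyMeasurable
  rw [h.map_environment_prod hY hX t, integral_map hm2.aemeasurable hφs.aestronglyMeasurable,
    Measure.integral_compProd] at hl
  rotate_left
  · exact integrable_of_abs_le (hφs.comp hm2) fun _ => h1 _
  · exact hl.symm

/-- `φ` averaged over one step of the chain from time `t`, minus the contribution of the part
`a • ν` of the kernel, which depends on the environment only. -/
noncomputable def residualStep (Q : Kernel (𝒳 × 𝒴) 𝒳) (ν : Measure 𝒳) (a : ℝ) (t : ℕ)
    (φ : 𝒳 × (ℤ → 𝒴) → ℝ) (p : 𝒳 × (ℤ → 𝒴)) : ℝ :=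
  ∫ z, φ (z, p.2) ∂Q (p.1, p.2 t) - a * ∫ z, φ (z, p.2) ∂ν

variable {ν : Measure 𝒳} [IsProbabilityMeasure ν] {a : ℝ} {φ : 𝒳 × (ℤ → 𝒴) → ℝ}

lemma measurable_integral_step (t : ℕ) (hφ : Measurable φ) :
    Measurable fun p : 𝒳 × (ℤ → 𝒴) => ∫ z, φ (z, p.2) ∂Q (p.1, p.2 t) := by
  have hg : Measurable fun p : 𝒳 × (ℤ → 𝒴) => (p.1, p.2 t) :=
    measurable_fst.prodMk ((measurable_pi_apply _).comp measurable_snd)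
  have hf : Measurable fun q : (𝒳 × (ℤ → 𝒴)) × 𝒳 => φ (q.2, q.1.2) :=
    hφ.comp (measurable_snd.prodMk (measurable_snd.comp measurable_fst))
  exact (hf.stronglyMeasurable.integral_kernel_prod_right' (κ := Q.comap _ hg)).measurable

lemma measurable_integral_environment (hφ : Measurable φ) :
    Measurable fun y : ℤ → 𝒴 => ∫ z, φ (z, y) ∂ν :=
  (hφ.comp measurable_swap).stronglyMeasurable.integral_prod_right'.measurable

lemma measurable_residualStep (t : ℕ) (hφ : Measurable φ) : Measurable (residualStep Q ν a t φ) :=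
  (measurable_integral_step t hφ).sub
    (((measurable_integral_environment hφ).comp measurable_snd).const_mul a)

omit [MeasurableSpace 𝒴] in
lemma abs_integral_section_le_one {μ : Measure 𝒳} [IsProbabilityMeasure μ]
    (h1 : ∀ p, |φ p| ≤ 1) (y : ℤ → 𝒴) : |∫ z, φ (z, y) ∂μ| ≤ 1 := by
  simpa using abs_integral_le_of_abs_le (μ := μ) fun z => h1 (z, y)

lemma abs_residualStep_le (t : ℕ) (ha : 0 ≤ a) (h1 : ∀ p, |φ p| ≤ 1) (p : 𝒳 × (ℤ → 𝒴)) :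
    |residualStep Q ν a t φ p| ≤ 1 + a := by
  refine (abs_sub _ _).trans (add_le_add (abs_integral_section_le_one h1 _) ?_)
  rw [abs_mul, abs_of_nonneg ha]
  exact mul_le_of_le_one_right ha (abs_integral_section_le_one h1 _)

lemma IsMCRE.integral_succ_eq_residualStep (hY : ∀ j, Measurable (Y j))
    (hX : ∀ t, Measurable (X t)) (h : IsMCRE P Q Y X) (t : ℕ) (hφ : Measurable φ)
    (h1 : ∀ p, |φ p| ≤ 1) :
    ∫ ω, φ (X (t + 1) ω, fun j => Y j ω) ∂P =
      ∫ ω, residualStep Q ν a t φ (X t ω, fun j => Y j ω) ∂P +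
        a * ∫ ω, ∫ z, φ (z, fun j => Y j ω) ∂ν ∂P := by
  have hYm := measurable_environment hY
  rw [h.integral_succ hY hX t hφ h1]
  unfold residualStep
  rw [integral_sub, integral_const_mul, sub_add_cancel]
  · exact integrable_of_abs_le ((measurable_integral_step t hφ).comp ((hX t).prodMk hYm))
      fun _ => abs_integral_section_le_one h1 _
  · exact (integrable_of_abs_le ((measurable_integral_environment hφ).comp hYm)
      fun _ => abs_integral_section_le_one h1 _).const_mul a

lemma abs_integral_sub_clip_le {f : Ω → ℝ} (hf : Measurable f) (ha0 : 0 ≤ a) (ha1 : a ≤ 1)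
    {G : Set Ω} (hG : MeasurableSet G) (hfb : ∀ ω, |f ω| ≤ 1 + a)
    (hfG : ∀ ω ∈ G, |f ω| ≤ 1 - a) :
    |∫ ω, f ω ∂P - ∫ ω, max (-(1 - a)) (min (f ω) (1 - a)) ∂P| ≤ 2 * a * P.real Gᶜ := by
  have hclip : ∀ ω, |max (-(1 - a)) (min (f ω) (1 - a))| ≤ 1 - a := fun ω =>
    abs_le.2 ⟨le_max_left _ _, max_le (by linarith) (min_le_right _ _)⟩
  rw [← integral_sub (integrable_of_abs_le hf hfb)
    (integrable_of_abs_le (μ := P) (by fun_prop) hclip)]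
  have hind : ∫ ω, Gᶜ.indicator (fun _ => 2 * a) ω ∂P = 2 * a * P.real Gᶜ := by
    rw [integral_indicator_const _ hG.compl, smul_eq_mul, mul_comm]
  have hdom : Integrable (Gᶜ.indicator fun _ => 2 * a) P :=
    (integrable_const (2 * a)).indicator hG.compl
  rw [← hind, ← Real.norm_eq_abs]
  refine norm_integral_le_of_norm_le hdom (ae_of_all _ fun ω => ?_)
  rw [Real.norm_eq_abs]
  by_cases hω : ω ∈ G
  · obtain ⟨hl, hr⟩ := abs_le.1 (hfG ω hω)
    rw [min_eq_left hr, max_eq_right hl]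
    simp [hω]
  · obtain ⟨hl, hr⟩ := abs_le.1 (hfb ω)
    rw [Set.indicator_of_mem (by exact hω)]
    rcases le_total (f ω) (1 - a) with h₁ | h₁
    · rw [min_eq_left h₁]
      rcases le_total (-(1 - a)) (f ω) with h₂ | h₂
      · rw [max_eq_right h₂]; simp [ha0]
      · rw [max_eq_left h₂, abs_le]; constructor <;> linarith
    · rw [min_eq_right h₁, max_eq_right (by linarith), abs_le]; constructor <;> linarith

/-- Quantitative loss of memory: away from the event that a chain leaves `A` or the environment
leaves `B`, each step contracts the difference of the two laws by the factor `1 - a`. -/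
lemma IsMCRE.abs_integral_sub_le (hY : ∀ j, Measurable (Y j)) (hX : ∀ t, Measurable (X t))
    (hX' : ∀ t, Measurable (X' t)) (h : IsMCRE P Q Y X) (h' : IsMCRE P Q Y X')
    {A : Set 𝒳} {B : Set 𝒴} (hA : MeasurableSet A) (hB : MeasurableSet B)
    (ha : a ∈ Set.Ioc (0 : ℝ) 1)
    (hminor : ∀ x ∈ A, ∀ y ∈ B, ∀ C, MeasurableSet C → ENNReal.ofReal a * ν C ≤ Q (x, y) C)
    {δ : ℝ} (hδ : ∀ t : ℕ, P.real {ω | X t ω ∉ A} + P.real {ω | Y t ω ∉ B} ≤ δ)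
    (hδ' : ∀ t : ℕ, P.real {ω | X' t ω ∉ A} + P.real {ω | Y t ω ∉ B} ≤ δ)
    (t : ℕ) {φ : 𝒳 × (ℤ → 𝒴) → ℝ} (hφ : Measurable φ) (h1 : ∀ p, |φ p| ≤ 1) :
    |∫ ω, φ (X t ω, fun j => Y j ω) ∂P - ∫ ω, φ (X' t ω, fun j => Y j ω) ∂P| ≤
      2 * (1 - a) ^ t + 4 * δ := by
  obtain ⟨ha0, ha1⟩ := ha
  have hδ0 : 0 ≤ δ := le_trans (by positivity) (hδ 0)
  have hYm := measurable_environment hY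
  induction t generalizing φ with
  | zero =>
    have hi := abs_integral_le_of_abs_le (μ := P) fun ω => h1 (X 0 ω, fun j => Y j ω)
    have hi' := abs_integral_le_of_abs_le (μ := P) fun ω => h1 (X' 0 ω, fun j => Y j ω)
    simp only [probReal_univ, mul_one] at hi hi'
    refine (abs_sub _ _).trans ?_
    simp only [pow_zero]
    linarith
  | succ t ih =>
    set ψ := residualStep Q ν a t φ with hψ
    have hψm : Measurable ψ := measurable_residualStep t hφ
    set χ : 𝒳 × (ℤ → 𝒴) → ℝ := fun p => max (-(1 - a)) (min (ψ p) (1 - a)) with hχ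
    have hχm : Measurable χ := by fun_prop
    have hχb : ∀ p, |χ p| ≤ 1 - a := fun p =>
      abs_le.2 ⟨le_max_left _ _, max_le (by linarith) (min_le_right _ _)⟩
    have hclip : ∀ Z : ℕ → Ω → 𝒳, (∀ t, Measurable (Z t)) →
        (∀ t : ℕ, P.real {ω | Z t ω ∉ A} + P.real {ω | Y t ω ∉ B} ≤ δ) →
        |∫ ω, ψ (Z t ω, fun j => Y j ω) ∂P - ∫ ω, χ (Z t ω, fun j => Y j ω) ∂P|
          ≤ 2 * a * δ := by
      intro Z hZ hZδ
      have hG : MeasurableSet (Z t ⁻¹' A ∩ Y t ⁻¹' B) := (hZ t hA).inter (hY t hB)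
      refine (abs_integral_sub_clip_le (hψm.comp ((hZ t).prodMk hYm)) ha0.le ha1 hG
        (fun ω => abs_residualStep_le t ha0.le h1 _) fun ω hω => ?_).trans ?_
      · exact abs_integral_sub_mul_integral_le ha0.le (hminor _ hω.1 _ hω.2)
          (hφ.comp measurable_prodMk_right) fun z => h1 _
      · refine mul_le_mul_of_nonneg_left (le_trans ?_ (hZδ t)) (by linarith)
        rw [Set.compl_inter]
        exact measureReal_union_le _ _
    have hχδ : |∫ ω, χ (X t ω, fun j => Y j ω) ∂P - ∫ ω, χ (X' t ω, fun j => Y j ω) ∂P| ≤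
        (1 - a) * (2 * (1 - a) ^ t + 4 * δ) := by
      rcases ha1.eq_or_lt with rfl | hlt
      · have hzero : χ = fun _ => 0 := funext fun p => abs_nonpos_iff.1 (by simpa using hχb p)
        simp [hzero]
      · have hpos : 0 < 1 - a := by linarith
        have := ih (φ := fun p => (1 - a)⁻¹ * χ p) (hχm.const_mul _) fun p => by
          rw [abs_mul, abs_of_pos (inv_pos.2 hpos), inv_mul_le_iff₀ hpos, mul_one]
          exact hχb p
        simp only [integral_const_mul] at this
        rwa [← mul_sub, abs_mul, abs_of_pos (inv_pos.2 hpos), inv_mul_le_iff₀ hpos] at this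
    rw [h.integral_succ_eq_residualStep (ν := ν) (a := a) hY hX t hφ h1,
      h'.integral_succ_eq_residualStep (ν := ν) (a := a) hY hX' t hφ h1, ← hψ,
      add_sub_add_right_eq_sub]
    have hc := abs_le.1 (hclip X hX hδ)
    have hc' := abs_le.1 (hclip X' hX' hδ')
    have hd := abs_le.1 hχδ
    rw [pow_succ, abs_le]
    constructor <;> linarith [hc.1, hc.2, hc'.1, hc'.2, hd.1, hd.2]

omit [IsProbabilityMeasure P] in
lemma measureReal_environment_notMem (hY : ∀ j, Measurable (Y j))
    (hstat : ∀ k : ℤ, P.map (fun ω => fun j : ℤ => Y (j + k) ω) =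
      P.map (fun ω => fun j : ℤ => Y j ω)) {B : Set 𝒴} (hB : MeasurableSet B) (k : ℤ) :
    P.real {ω | Y k ω ∉ B} = P.real {ω | Y 0 ω ∉ B} := by
  have hS : MeasurableSet {y : ℤ → 𝒴 | y 0 ∉ B} :=
    (measurable_pi_apply (0 : ℤ) : Measurable fun y : ℤ → 𝒴 => y 0) hB.compl
  have := congrArg (fun μ : Measure (ℤ → 𝒴) => μ.real {y | y 0 ∉ B}) (hstat k)
  simp only [map_measureReal_apply (measurable_pi_lambda _ fun j => hY (j + k)) hS,
    map_measureReal_apply (measurable_environment hY) hS] at this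
  simpa using this

omit [IsProbabilityMeasure P] in
lemma tendsto_toReal_iSup_measure {s : ℕ → ℕ → Set Ω}
    (h : Tendsto (fun n => ⨆ t, P (s n t)) atTop (nhds 0)) :
    Tendsto (fun n => (⨆ t, P (s n t)).toReal) atTop (nhds 0) :=
  (ENNReal.tendsto_toReal ENNReal.zero_ne_top).comp h

lemma measureReal_le_toReal_iSup (s : ℕ → Set Ω) (t : ℕ) :
    P.real (s t) ≤ (⨆ t, P (s t)).toReal :=
  ENNReal.toReal_mono ((iSup_le fun _ => prob_le_one).trans_lt ENNReal.one_lt_top).ne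
    (le_iSup (fun t => P (s t)) t)

end RandomEnvironment

theorem mcre_limit_independent_of_initial_condition
    {𝒳 𝒴 : Type*} [MeasurableSpace 𝒳] [TopologicalSpace 𝒳] [PolishSpace 𝒳] [BorelSpace 𝒳]
    [MeasurableSpace 𝒴] [TopologicalSpace 𝒴] [PolishSpace 𝒴] [BorelSpace 𝒴]
    {Ω : Type*} [MeasurableSpace Ω] (P : Measure Ω) [IsProbabilityMeasure P]
    -- stationary environment
    (Y : ℤ → Ω → 𝒴) (hYmeas : ∀ j, Measurable (Y j))
    (hYstat : ∀ k : ℤ, Measure.map (fun ω => fun j : ℤ => Y (j + k) ω) P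
      = Measure.map (fun ω => fun j : ℤ => Y j ω) P)
    -- parametrized family of transition kernels
    (Q : Kernel (𝒳 × 𝒴) 𝒳) [IsMarkovKernel Q]
    (Xs : ℕ → Set 𝒳) (hXsmeas : ∀ n, MeasurableSet (Xs n)) (hXsmono : Monotone Xs)
    (hXs0 : (Xs 0).Nonempty)
    (Ys : ℕ → Set 𝒴) (hYsmeas : ∀ n, MeasurableSet (Ys n)) (hYsmono : Monotone Ys)
    (hYs0 : (Ys 0).Nonempty)
    -- Assumption (M')
    (α : ℕ → ℝ) (hα : ∀ n, α n ∈ Set.Ioc (0:ℝ) 1) (hαanti : Antitone α)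
    (ν : ℕ → Measure 𝒳) (hν : ∀ n, IsProbabilityMeasure (ν n))
    (hminor : ∀ n, ∀ x ∈ Xs n, ∀ y ∈ Ys n, ∀ A : Set 𝒳, MeasurableSet A →
      ENNReal.ofReal (α n) * ν n A ≤ Q (x, y) A)
    -- P(Y₀ ∉ 𝒴ₙ) → 0
    (hY0 : Tendsto (fun n => P {ω | Y 0 ω ∉ Ys n}) atTop (nhds 0))
    -- two chains in the same random environment
    (X X' : ℕ → Ω → 𝒳) (hXmeas : ∀ t, Measurable (X t)) (hX'meas : ∀ t, Measurable (X' t))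
    (hmcre : IsMCRE P Q Y X) (hmcre' : IsMCRE P Q Y X')
    -- both initial conditions in 𝔐_b
    (htight : Tendsto (fun n => ⨆ t, P {ω | X t ω ∉ Xs n}) atTop (nhds 0))
    (htight' : Tendsto (fun n => ⨆ t, P {ω | X' t ω ∉ Xs n}) atTop (nhds 0)) :
    Tendsto (fun t : ℕ =>
        tvDist (Measure.map (fun ω => (X t ω, fun k : ℤ => Y ((t : ℤ) + k) ω)) P)
          (Measure.map (fun ω => (X' t ω, fun k : ℤ => Y ((t : ℤ) + k) ω)) P))
      atTop (nhds 0) ∧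
    ∀ μsharp : Measure (𝒳 × (ℤ → 𝒴)), IsProbabilityMeasure μsharp →
      Tendsto (fun t : ℕ =>
          tvDist (Measure.map (fun ω => (X t ω, fun k : ℤ => Y ((t : ℤ) + k) ω)) P) μsharp)
        atTop (nhds 0) →
      Tendsto (fun t : ℕ =>
          tvDist (Measure.map (fun ω => (X' t ω, fun k : ℤ => Y ((t : ℤ) + k) ω)) P) μsharp)
        atTop (nhds 0) := by
  set L : (ℕ → Ω → 𝒳) → ℕ → Measure (𝒳 × (ℤ → 𝒴)) := fun Z t =>
    Measure.map (fun ω => (Z t ω, fun k : ℤ => Y ((t : ℤ) + k) ω)) P with hL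
  have hmeas : ∀ Z : ℕ → Ω → 𝒳, (∀ t, Measurable (Z t)) → ∀ t : ℕ,
      Measurable fun ω => (Z t ω, fun k : ℤ => Y ((t : ℤ) + k) ω) := fun Z hZ t =>
    (hZ t).prodMk (measurable_pi_lambda _ fun k => hYmeas _)
  have hprob : ∀ Z : ℕ → Ω → 𝒳, (∀ t, Measurable (Z t)) → ∀ t, IsProbabilityMeasure (L Z t) :=
    fun Z hZ t => Measure.isProbabilityMeasure_map (hmeas Z hZ t).aemeasurable
  set b : ℕ → ℝ := fun n => (⨆ t, P {ω | X t ω ∉ Xs n}).toReal +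
    (⨆ t, P {ω | X' t ω ∉ Xs n}).toReal + P.real {ω | Y 0 ω ∉ Ys n} with hb
  have hb0 : Tendsto b atTop (nhds 0) := by
    have hY0' : Tendsto (fun n => P.real {ω | Y 0 ω ∉ Ys n}) atTop (nhds 0) :=
      (ENNReal.tendsto_toReal ENNReal.zero_ne_top).comp hY0
    simpa using ((tendsto_toReal_iSup_measure htight).add
      (tendsto_toReal_iSup_measure htight')).add hY0'
  have hbound : ∀ n t, tvDist (L X t) (L X' t) ≤ 2 * (1 - α n) ^ t + 4 * b n := by
    intro n t
    refine tvDist_le fun φ hφ h1 => ?_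
    rw [hL, integral_map (hmeas X hXmeas t).aemeasurable hφ.aestronglyMeasurable,
      integral_map (hmeas X' hX'meas t).aemeasurable hφ.aestronglyMeasurable]
    have := hν n
    have hshift : Measurable fun p : 𝒳 × (ℤ → 𝒴) => (p.1, fun k : ℤ => p.2 ((t : ℤ) + k)) :=
      measurable_fst.prodMk
        (measurable_pi_lambda _ fun k => (measurable_pi_apply _).comp measurable_snd)
    refine hmcre.abs_integral_sub_le hYmeas hXmeas hX'meas hmcre' (hXsmeas n) (hYsmeas n) (hα n)
      (hminor n) (fun s => ?_) (fun s => ?_) t (hφ.comp hshift) fun p => h1 _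
    · rw [measureReal_environment_notMem hYmeas hYstat (hYsmeas n)]
      have := measureReal_le_toReal_iSup (P := P) (fun t => {ω | X t ω ∉ Xs n}) s
      have : 0 ≤ (⨆ t, P {ω | X' t ω ∉ Xs n}).toReal := ENNReal.toReal_nonneg
      simp only [hb]
      linarith
    · rw [measureReal_environment_notMem hYmeas hYstat (hYsmeas n)]
      have := measureReal_le_toReal_iSup (P := P) (fun t => {ω | X' t ω ∉ Xs n}) s
      have : 0 ≤ (⨆ t, P {ω | X t ω ∉ Xs n}).toReal := ENNReal.toReal_nonneg
      simp only [hb]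
      linarith
  have hlim : Tendsto (fun t => tvDist (L X t) (L X' t)) atTop (nhds 0) := by
    refine tendsto_order.2 ⟨fun c hc => Eventually.of_forall fun t =>
      hc.trans_le (tvDist_nonneg _ _), fun ε hε => ?_⟩
    obtain ⟨n, hn⟩ := (hb0.eventually (gt_mem_nhds (show 0 < ε / 8 by positivity))).exists
    have hpow : Tendsto (fun t : ℕ => (1 - α n) ^ t) atTop (nhds 0) :=
      tendsto_pow_atTop_nhds_zero_of_lt_one (by linarith [(hα n).2]) (by linarith [(hα n).1])
    filter_upwards [hpow.eventually (gt_mem_nhds (show 0 < ε / 4 by positivity))] with t ht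
    linarith [hbound n t]
  refine ⟨hlim, fun μsharp _ hμ => ?_⟩
  refine squeeze_zero (fun t => tvDist_nonneg _ _) (fun t => ?_) (by simpa using hlim.add hμ)
  have := hprob X hXmeas t
  have := hprob X' hX'meas t
  exact tvDist_le_add
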